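/- arXiv:1806.07586 — 2 statements merged into one kernel-verified Lean document; each statement's English description precedes it below -/
import Mathlib

section
/- The number of minimum-length solutions to Disjoint A,B-paths on the instance I satisfies S_{A,B} = m · 2^{|E| − 3α(G)}, where m is the number of maximum independent sets of G; equivalently, the number of maximum independent sets of G equals S_{A,B} / 2^{|E| − 3α(G)}. -/
/-- `f` is a family of `(|A|+|B|)/2` pairwise vertex-disjoint simple paths of `G`,
each with both endpoints in `A` or both endpoints in `B`, such that every vertex of
`A ∪ B` is an endpoint of one of the paths, and `E'` is the union of their edge
sets.  This witnesses that `E'` is a solution to Disjoint `A`,`B`-paths. -/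
def IsPathFamily {V : Type} [DecidableEq V] (G : SimpleGraph V) (A B : Finset V)
    (E' : Set (Sym2 V)) {k : ℕ} (f : Fin k → (u : V) × (v : V) × G.Walk u v) : Prop :=
  k = (A.card + B.card) / 2 ∧
  (∀ i, (f i).2.2.IsPath) ∧
  (∀ i, ((f i).1 ∈ A ∧ (f i).2.1 ∈ A) ∨ ((f i).1 ∈ B ∧ (f i).2.1 ∈ B)) ∧
  (∀ i j, i ≠ j → ∀ x, x ∈ (f i).2.2.support → x ∉ (f j).2.2.support) ∧
  (∀ z, z ∈ A ∪ B → ∃ i, z = (f i).1 ∨ z = (f i).2.1) ∧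
  E' = ⋃ i, {e | e ∈ (f i).2.2.edges}

/-- `E'` is a solution to Disjoint `A`,`B`-paths on `G`. -/
def IsSolution {V : Type} [DecidableEq V] (G : SimpleGraph V) (A B : Finset V)
    (E' : Set (Sym2 V)) : Prop :=
  ∃ (k : ℕ) (f : Fin k → (u : V) × (v : V) × G.Walk u v), IsPathFamily G A B E' f

/-- The length of an edge set: the sum of the lengths of its edges. -/
noncomputable def lengthOf {V : Type} (ℓ : Sym2 V → ℕ) (E' : Set (Sym2 V)) : ℕ :=
  ∑ᶠ e ∈ E', ℓ e

/-- `ℓ_{A,B}`: the minimum length of a solution to Disjoint `A`,`B`-paths. -/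
noncomputable def lAB {V : Type} [DecidableEq V] (G : SimpleGraph V) (A B : Finset V)
    (ℓ : Sym2 V → ℕ) : ℕ :=
  sInf {n | ∃ E', IsSolution G A B E' ∧ lengthOf ℓ E' = n}

/-- `S_{A,B}`: the number of minimum-length solutions to Disjoint `A`,`B`-paths. -/
noncomputable def nSol {V : Type} [DecidableEq V] (G : SimpleGraph V) (A B : Finset V)
    (ℓ : Sym2 V → ℕ) : ℕ :=
  Set.ncard {E' | IsSolution G A B E' ∧ lengthOf ℓ E' = lAB G A B ℓ}


/-- Vertex type of the instance `I`: `Sum.inl (v, i)` is the gadget-cycle vertex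
`v′_{i+1}` (for `v ∈ V`, `i : Fin 8`), and `Sum.inr (e, k)` is the edge-gadget
vertex `w′_{k+1}(e)` (used only for edges `e` of `G`). -/
abbrev IVert (V : Type) : Type := (V × Fin 8) ⊕ (Sym2 V × Fin 2)

/-- Base relation of the instance `I`: for each vertex `v` of `G` an 8-cycle
`v′₁ … v′₈`, and for each edge `e = uv` of `G` (with `fs e = u`, `sn e = v`) the four
edges `w′₁(e)u′_{σ_u(e)}`, `w′₂(e)u′_{σ_u(e)+1}`, `w′₁(e)v′_{σ_v(e)+1}`,
`w′₂(e)v′_{σ_v(e)}` (in the `Fin 8`-indexing, `v′_m` is `Sum.inl (v, m-1)`). -/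
def iRel {V : Type} (G : SimpleGraph V) (σ : V → Sym2 V → ℕ) (fs sn : Sym2 V → V) :
    IVert V → IVert V → Prop
  | .inl (v, i), .inl (w, j) =>
      v = w ∧ (i.val + 1 = j.val ∨ (i.val = 7 ∧ j.val = 0))
  | .inr (e, k), .inl (w, i) => e ∈ G.edgeSet ∧
      ((k = 0 ∧ w = fs e ∧ i.val + 1 = σ w e) ∨
       (k = 1 ∧ w = fs e ∧ i.val = σ w e) ∨
       (k = 0 ∧ w = sn e ∧ i.val = σ w e) ∨
       (k = 1 ∧ w = sn e ∧ i.val + 1 = σ w e))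
  | _, _ => False

/-- The graph of the instance `I`. -/
def instGraph {V : Type} (G : SimpleGraph V) (σ : V → Sym2 V → ℕ)
    (fs sn : Sym2 V → V) : SimpleGraph (IVert V) :=
  SimpleGraph.fromRel (iRel G σ fs sn)

open Classical in
/-- Edge lengths of the instance `I`: the cycle edge `v′₈v′₁` has length `12`, the
cycle edges `v′ᵢv′ᵢ₊₁` with `i` odd (`Fin`-index even) have length `2`, and all other
edges have length `1`. -/
noncomputable def instLen {V : Type} : Sym2 (IVert V) → ℕ := fun ε =>
  if ∃ v : V, ε = s((Sum.inl (v, (7 : Fin 8)) : IVert V), Sum.inl (v, (0 : Fin 8)))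
  then 12
  else if ∃ (v : V) (i j : Fin 8), i.val % 2 = 0 ∧ i.val + 1 = j.val ∧
      ε = s((Sum.inl (v, i) : IVert V), Sum.inl (v, j))
  then 2
  else 1

/-- The terminal set `A` of the instance `I`: the vertices `v′₁` and `v′₈`, `v ∈ V`. -/
def instA (V : Type) [Fintype V] [DecidableEq V] : Finset (IVert V) :=
  Finset.univ.image (fun v : V => (Sum.inl (v, (0 : Fin 8)) : IVert V)) ∪
    Finset.univ.image (fun v : V => (Sum.inl (v, (7 : Fin 8)) : IVert V))

/-- The terminal set `B` of the instance `I`: the vertices `w′₁(e)` and `w′₂(e)`,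
`e ∈ E`. -/
def instB {V : Type} [Fintype V] [DecidableEq V] (G : SimpleGraph V)
    [DecidableRel G.Adj] : Finset (IVert V) :=
  G.edgeFinset.image (fun e => (Sum.inr (e, (0 : Fin 2)) : IVert V)) ∪
    G.edgeFinset.image (fun e => (Sum.inr (e, (1 : Fin 2)) : IVert V))

/-- The independence number `α(G)`. -/
noncomputable def indepNum {V : Type} (G : SimpleGraph V) : ℕ :=
  sSup {n | ∃ S : Finset V, (∀ u ∈ S, ∀ w ∈ S, ¬ G.Adj u w) ∧ S.card = n}

/-- The hypotheses on the labelling data used to build the instance. -/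
structure IsLabelling {V : Type} (G : SimpleGraph V) (σ : V → Sym2 V → ℕ)
    (fs sn : Sym2 V → V) : Prop where
  eq_mk : ∀ e ∈ G.edgeSet, e = s(fs e, sn e)
  mem : ∀ v : V, ∀ e ∈ G.incidenceSet v, σ v e = 2 ∨ σ v e = 4 ∨ σ v e = 6
  inj : ∀ v : V, Set.InjOn (σ v) (G.incidenceSet v)

open Classical in
/-- The index `k` of the vertex `w′ₖ₊₁(e)` joined to `x′_{σ_x(e)}`. -/
noncomputable def side {V : Type} (fs : Sym2 V → V) (x : V) (e : Sym2 V) : Fin 2 :=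
  if x = fs e then 0 else 1

/-- The edges of the path `v′₁ … v′₈`. -/
def longEdges {V : Type} (v : V) : Set (Sym2 (IVert V)) :=
  {ε | ∃ i j : Fin 8, i.val + 1 = j.val ∧ ε = s(Sum.inl (v, i), Sum.inl (v, j))}

/-- The edges of the path of length three joining `w′₁(e)` and `w′₂(e)` through the
gadget of `x`. -/
def detourEdges {V : Type} (σ : V → Sym2 V → ℕ) (fs : Sym2 V → V) (e : Sym2 V) (x : V) :
    Set (Sym2 (IVert V)) :=
  {ε | ∃ i j : Fin 8, i.val + 1 = σ x e ∧ j.val = σ x e ∧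
    (ε = s(Sum.inr (e, side fs x e), Sum.inl (x, i)) ∨ ε = s(Sum.inl (x, i), Sum.inl (x, j)) ∨
      ε = s(Sum.inr (e, 1 - side fs x e), Sum.inl (x, j)))}

/-- The edge set given by a set `S` of vertices whose gadgets are traversed completely and a
choice of an endpoint for every edge. -/
def selection {V : Type} (G : SimpleGraph V) (σ : V → Sym2 V → ℕ) (fs : Sym2 V → V)
    (S : Finset V) (x : G.edgeSet → V) : Set (Sym2 (IVert V)) :=
  {ε | (∃ v ∉ S, ε = s(Sum.inl (v, 0), Sum.inl (v, 7))) ∨ (∃ v ∈ S, ε ∈ longEdges v) ∨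
    ∃ e : G.edgeSet, ε ∈ detourEdges σ fs e (x e)}

section Family

variable {W : Type} {G : SimpleGraph W} {A B : Finset W}

theorem IsPathFamily.endpoints_ne [DecidableEq W] {E' : Set (Sym2 W)} {k : ℕ}
    {f : Fin k → (u : W) × (v : W) × G.Walk u v} (h : IsPathFamily G A B E' f)
    (hAB : Disjoint A B) (hev : Even (A.card + B.card)) (i : Fin k) : (f i).1 ≠ (f i).2.1 := by
  obtain ⟨hk, -, -, -, hc, -⟩ := h
  let g : Fin k × Bool → W := fun p => if p.2 then (f p.1).1 else (f p.1).2.1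
  have hsub : A ∪ B ⊆ Finset.univ.image g := by
    intro z hz
    obtain ⟨i, hi | hi⟩ := hc z hz
    · exact Finset.mem_image.2 ⟨(i, true), Finset.mem_univ _, by simp [g, hi]⟩
    · exact Finset.mem_image.2 ⟨(i, false), Finset.mem_univ _, by simp [g, hi]⟩
  have hcard := Finset.card_le_card hsub
  rw [Finset.card_union_of_disjoint hAB] at hcard
  have hinj : Set.InjOn g (Finset.univ : Finset (Fin k × Bool)) := by
    rw [← Finset.card_image_iff]
    refine le_antisymm Finset.card_image_le (le_trans ?_ hcard)
    simp only [Finset.card_univ, Fintype.card_prod, Fintype.card_fin, Fintype.card_bool]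
    obtain ⟨r, hr⟩ := hev
    omega
  intro heq
  have := hinj (Finset.mem_coe.2 (Finset.mem_univ (i, true)))
    (Finset.mem_coe.2 (Finset.mem_univ (i, false))) (by simp [g, heq])
  simp at this

theorem IsPathFamily.exists_walk [DecidableEq W] {E' : Set (Sym2 W)} {k : ℕ}
    {f : Fin k → (u : W) × (v : W) × G.Walk u v} (h : IsPathFamily G A B E' f)
    (hAB : Disjoint A B) (hev : Even (A.card + B.card)) (i : Fin k) (z : W)
    (hz : z = (f i).1 ∨ z = (f i).2.1) :
    ∃ (y : W) (q : G.Walk z y), q.IsPath ∧ y ≠ z ∧ (z ∈ A ∧ y ∈ A ∨ z ∈ B ∧ y ∈ B) ∧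
      (∀ t, t ∈ q.support ↔ t ∈ (f i).2.2.support) ∧ q.edges.Perm (f i).2.2.edges ∧
      ∀ t ∈ A ∪ B, t ∈ q.support → t = z ∨ t = y := by
  have hne := h.endpoints_ne hAB hev i
  obtain ⟨hk, hp, he, hd, hc, -⟩ := h
  have hterm : ∀ t ∈ A ∪ B, t ∈ (f i).2.2.support → t = (f i).1 ∨ t = (f i).2.1 := by
    intro t ht hts
    obtain ⟨j, hj⟩ := hc t ht
    by_cases hij : i = j
    · subst hij; exact hj
    · refine absurd ?_ (hd i j hij t hts)
      rcases hj with rfl | rfl <;> simp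
  have hpi := hp i
  have hei := he i
  generalize f i = g at *
  obtain ⟨u, v, p⟩ := g
  simp only at *
  rcases hz with rfl | rfl
  · exact ⟨v, p, hpi, hne.symm, hei, fun _ => Iff.rfl, .refl _, hterm⟩
  · refine ⟨u, p.reverse, hpi.reverse, hne, hei.imp And.symm And.symm, by simp, ?_, ?_⟩
    · rw [SimpleGraph.Walk.edges_reverse]; exact List.reverse_perm _
    · intro t ht hts
      exact (hterm t ht (by simpa using hts)).symm

theorem IsPathFamily.lengthOf_eq [DecidableEq W] {E' : Set (Sym2 W)} {k : ℕ}
    {f : Fin k → (u : W) × (v : W) × G.Walk u v} (h : IsPathFamily G A B E' f)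
    (ℓ : Sym2 W → ℕ) : lengthOf ℓ E' = ∑ i, ((f i).2.2.edges.map ℓ).sum := by
  obtain ⟨hk, hp, he, hd, hc, rfl⟩ := h
  have hset : (⋃ i, {e | e ∈ (f i).2.2.edges}) =
      ((Finset.univ.biUnion fun i => (f i).2.2.edges.toFinset : Finset (Sym2 W)) :
        Set (Sym2 W)) := by
    ext; simp
  rw [lengthOf, hset, finsum_mem_coe_finset, Finset.sum_biUnion]
  · refine Finset.sum_congr rfl fun i _ => ?_
    rw [List.sum_toFinset]
    exact (hp i).isTrail.edges_nodup
  · intro i _ j _ hij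
    rw [Function.onFun, Finset.disjoint_left]
    intro ε h1 h2
    rw [List.mem_toFinset] at h1 h2
    induction ε with
    | h a b =>
      exact hd i j hij a ((f i).2.2.fst_mem_support_of_mem_edges h1)
        ((f j).2.2.fst_mem_support_of_mem_edges h2)

theorem isSolution_of_fintype [DecidableEq W] {ι : Type} [Fintype ι] {E' : Set (Sym2 W)}
    (g : ι → (u : W) × (v : W) × G.Walk u v) (ℓ : Sym2 W → ℕ)
    (hk : Fintype.card ι = (A.card + B.card) / 2) (hp : ∀ i, (g i).2.2.IsPath)
    (he : ∀ i, ((g i).1 ∈ A ∧ (g i).2.1 ∈ A) ∨ ((g i).1 ∈ B ∧ (g i).2.1 ∈ B))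
    (hd : ∀ i j, i ≠ j → ∀ x, x ∈ (g i).2.2.support → x ∉ (g j).2.2.support)
    (hc : ∀ z, z ∈ A ∪ B → ∃ i, z = (g i).1 ∨ z = (g i).2.1)
    (hE : ∀ ε, ε ∈ E' ↔ ∃ i, ε ∈ (g i).2.2.edges) :
    IsSolution G A B E' ∧ lengthOf ℓ E' = ∑ i, ((g i).2.2.edges.map ℓ).sum := by
  let φ := (Fintype.equivFin ι).symm
  have hfam : IsPathFamily G A B E' (fun i => g (φ i)) := by
    refine ⟨hk, fun i => hp _, fun i => he _, fun i j hij => hd _ _ (φ.injective.ne hij), ?_, ?_⟩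
    · intro z hz
      obtain ⟨i, hi⟩ := hc z hz
      obtain ⟨j, rfl⟩ := φ.surjective i
      exact ⟨j, hi⟩
    · ext ε
      rw [hE, Set.mem_iUnion, φ.surjective.exists]
      rfl
  refine ⟨⟨_, _, hfam⟩, ?_⟩
  rw [hfam.lengthOf_eq, φ.sum_comp (fun t => ((g t).2.2.edges.map ℓ).sum)]

end Family

section Instance

variable {V : Type} {G : SimpleGraph V} {σ : V → Sym2 V → ℕ} {fs sn : Sym2 V → V}

theorem instGraph_adj_inl_inl {v w : V} {i j : Fin 8} :
    (instGraph G σ fs sn).Adj (Sum.inl (v, i)) (Sum.inl (w, j)) ↔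
      v = w ∧ (i.val + 1 = j.val ∨ j.val + 1 = i.val ∨ (i = 7 ∧ j = 0) ∨ (i = 0 ∧ j = 7)) := by
  simp only [instGraph, SimpleGraph.fromRel_adj, iRel, ne_eq, Sum.inl.injEq, Prod.mk.injEq]
  constructor
  · rintro ⟨-, ⟨rfl, h⟩ | ⟨rfl, h⟩⟩ <;> refine ⟨rfl, ?_⟩ <;> omega
  · rintro ⟨rfl, h⟩
    refine ⟨by rintro ⟨-, rfl⟩; omega, ?_⟩
    simp only [true_and]
    omega

theorem instGraph_not_adj_inr_inr {a b : Sym2 V × Fin 2} :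
    ¬ (instGraph G σ fs sn).Adj (Sum.inr a) (Sum.inr b) := by
  simp [instGraph, SimpleGraph.fromRel_adj, iRel]

theorem IsLabelling.fs_ne_sn (hL : IsLabelling G σ fs sn) {e : Sym2 V} (he : e ∈ G.edgeSet) :
    fs e ≠ sn e := by
  have := he
  rw [hL.eq_mk e he, SimpleGraph.mem_edgeSet] at this
  exact this.ne

theorem IsLabelling.adj_inr_inl (hL : IsLabelling G σ fs sn) {e : Sym2 V} {k : Fin 2} {x : V}
    {i : Fin 8} :
    (instGraph G σ fs sn).Adj (Sum.inr (e, k)) (Sum.inl (x, i)) ↔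
      e ∈ G.incidenceSet x ∧
        (i.val + 1 = σ x e ∧ k = side fs x e ∨ i.val = σ x e ∧ k = 1 - side fs x e) := by
  simp only [instGraph, SimpleGraph.fromRel_adj, iRel, ne_eq, reduceCtorEq, not_false_eq_true,
    or_false, true_and, SimpleGraph.incidenceSet, Set.mem_ofPred_eq, and_assoc]
  refine and_congr_right fun he => ?_
  have hne := hL.fs_ne_sn he
  have hmem : x ∈ e ↔ x = fs e ∨ x = sn e := by
    conv_lhs => rw [hL.eq_mk e he]
    simp
  rw [hmem]
  by_cases h1 : x = fs e
  · have h2 : x ≠ sn e := h1 ▸ hne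
    simp [side, ← h1, h2]
    tauto
  · by_cases h2 : x = sn e
    · simp [side, h1, ← h2]
      tauto
    · simp [h1, h2]

theorem instLen_inr_inl {a : Sym2 V × Fin 2} {b : V × Fin 8} :
    instLen s((Sum.inr a : IVert V), Sum.inl b) = 1 := by
  simp [instLen]

theorem instLen_chord {v : V} :
    instLen s((Sum.inl (v, 0) : IVert V), Sum.inl (v, 7)) = 12 := by
  rw [instLen, if_pos ⟨v, Sym2.eq_swap⟩]

theorem instLen_step {v : V} {i j : Fin 8} (h : i.val + 1 = j.val) :
    instLen s((Sum.inl (v, i) : IVert V), Sum.inl (v, j)) = if i.val % 2 = 0 then 2 else 1 := by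
  rw [instLen, if_neg]
  · split_ifs with h1 h2 h2
    · rfl
    · obtain ⟨w, a, b, h3, h4, h5⟩ := h1
      simp only [Sym2.eq_iff, Sum.inl.injEq, Prod.mk.injEq] at h5
      omega
    · exact absurd ⟨v, i, j, h2, h, rfl⟩ h1
    · rfl
  · rintro ⟨w, h5⟩
    simp only [Sym2.eq_iff, Sum.inl.injEq, Prod.mk.injEq] at h5
    omega

theorem instLen_pos (ε : Sym2 (IVert V)) : 1 ≤ instLen ε := by
  unfold instLen
  split_ifs <;> simp


theorem mem_edgeSet_of_adj_inr {a : Sym2 V × Fin 2} {z : IVert V}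
    (h : (instGraph G σ fs sn).Adj (Sum.inr a) z) : a.1 ∈ G.edgeSet := by
  obtain z | z := z
  · simp only [instGraph, SimpleGraph.fromRel_adj, iRel, or_false] at h
    exact h.2.1
  · exact absurd h instGraph_not_adj_inr_inr

theorem exists_step_of_not_inr {y : IVert V} {v : V} {i : Fin 8}
    (q : (instGraph G σ fs sn).Walk (Sum.inl (v, i)) y) (hy : y ≠ Sum.inl (v, i))
    (hr : ∀ a, a.1 ∈ G.edgeSet → Sum.inr a ∉ q.support) :
    ∃ (j : Fin 8) (h : (instGraph G σ fs sn).Adj (Sum.inl (v, i)) (Sum.inl (v, j)))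
      (p : (instGraph G σ fs sn).Walk (Sum.inl (v, j)) y), q = .cons h p := by
  cases q with
  | nil => exact absurd rfl hy
  | @cons _ b _ h p =>
    obtain ⟨w, j⟩ | b := b
    · obtain ⟨rfl, -⟩ := instGraph_adj_inl_inl.1 h
      exact ⟨j, h, p, rfl⟩
    · exact absurd (by simp) (hr b (mem_edgeSet_of_adj_inr h.symm))

theorem walk_eq_climb {y : IVert V} {v : V} (n : ℕ) :
    ∀ (i : Fin 8) (q : (instGraph G σ fs sn).Walk (Sum.inl (v, i)) y), i.val + n = 7 → 0 < i.val →
      q.IsPath → (∀ j, j < i → Sum.inl (v, j) ∉ q.support) → (∀ a, a.1 ∈ G.edgeSet → Sum.inr a ∉ q.support) →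
      (∃ w, y = Sum.inl (w, 0) ∨ y = Sum.inl (w, 7)) →
      (Sum.inl (v, 7) ∈ q.support → y = Sum.inl (v, 7)) →
      y = Sum.inl (v, 7) ∧ (∀ j, i ≤ j → Sum.inl (v, j) ∈ q.support) ∧
      (∀ ε, ε ∈ q.edges ↔ ∃ a b : Fin 8, i ≤ a ∧ a.val + 1 = b.val ∧
        ε = s(Sum.inl (v, a), Sum.inl (v, b))) ∧
      (q.edges.map instLen).sum = 7 - i.val + (8 - i.val) / 2 := by
  induction n with
  | zero =>
    intro i q hi hi0 hp hj hr hy h7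
    obtain rfl : i = 7 := by omega
    obtain rfl := h7 (by simp)
    obtain rfl := (SimpleGraph.Walk.isPath_iff_nil.1 hp).eq_nil
    refine ⟨rfl, fun j hj => ?_, fun ε => ?_, by simp⟩
    · obtain rfl : j = 7 := by omega
      simp
    · simp only [SimpleGraph.Walk.edges_nil, List.not_mem_nil, false_iff]
      rintro ⟨a, b, h1, h2, -⟩
      omega
  | succ n ih =>
    intro i q hi hi0 hp hj hr hy h7
    have hyne : y ≠ Sum.inl (v, i) := by
      rintro rfl
      obtain ⟨w, h | h⟩ := hy <;>
        simp only [Sum.inl.injEq, Prod.mk.injEq] at h <;> omega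
    obtain ⟨j, h, p, rfl⟩ := exists_step_of_not_inr q hyne hr
    rw [SimpleGraph.Walk.cons_isPath_iff] at hp
    have hij : i.val + 1 = j.val := by
      have h1 := (instGraph_adj_inl_inl.1 h).2
      have h2 : ¬ j < i := fun h' => hj j h' (by simp)
      omega
    obtain ⟨hy7, hs, he, hc⟩ := ih j p (by omega) (by omega) hp.1 (by
        intro l hl hmem
        by_cases hli : l = i
        · exact hp.2 (hli ▸ hmem)
        · exact hj l (by omega) (by simp [hmem])) (fun a hE ha => hr a hE (by simp [ha])) hy
        (fun h' => h7 (by simp [h']))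
    refine ⟨hy7, fun l hl => ?_, fun ε => ?_, ?_⟩
    · by_cases hli : l = i
      · simp [hli]
      · simp [hs l (by omega)]
    · rw [SimpleGraph.Walk.edges_cons, List.mem_cons, he]
      constructor
      · rintro (rfl | ⟨a, b, h1, h2, rfl⟩)
        · exact ⟨i, j, le_rfl, hij, rfl⟩
        · exact ⟨a, b, by omega, h2, rfl⟩
      · rintro ⟨a, b, h1, h2, rfl⟩
        by_cases hai : a = i
        · left
          obtain rfl : b = j := by omega
          rw [hai]
        · exact .inr ⟨a, b, by omega, h2, rfl⟩
    · rw [SimpleGraph.Walk.edges_cons, List.map_cons, List.sum_cons, hc, instLen_step hij]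
      split_ifs <;> omega

/-- A path between terminals of `A` starting at `v′₁` is either the edge `v′₁v′₈` or the path
`v′₁ … v′₈`. -/
theorem walk_from_first {y : IVert V} {v : V}
    (q : (instGraph G σ fs sn).Walk (Sum.inl (v, 0)) y) (hp : q.IsPath)
    (hne : y ≠ Sum.inl (v, 0)) (hr : ∀ a, a.1 ∈ G.edgeSet → Sum.inr a ∉ q.support)
    (hy : ∃ w, y = Sum.inl (w, 0) ∨ y = Sum.inl (w, 7))
    (h7 : Sum.inl (v, 7) ∈ q.support → y = Sum.inl (v, 7)) :
    y = Sum.inl (v, 7) ∧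
      (((∀ ε, ε ∈ q.edges ↔ ε = s(Sum.inl (v, 0), Sum.inl (v, 7))) ∧
          (q.edges.map instLen).sum = 12) ∨
        ((∀ ε, ε ∈ q.edges ↔ ε ∈ longEdges v) ∧ (∀ j, Sum.inl (v, j) ∈ q.support) ∧
          (q.edges.map instLen).sum = 11)) := by
  obtain ⟨j, h, p, rfl⟩ := exists_step_of_not_inr q hne hr
  rw [SimpleGraph.Walk.cons_isPath_iff] at hp
  have hj : j = 7 ∨ j = 1 := by
    have := (instGraph_adj_inl_inl.1 h).2
    omega
  obtain rfl | rfl := hj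
  · obtain rfl := h7 (by simp)
    obtain rfl := (SimpleGraph.Walk.isPath_iff_nil.1 hp.1).eq_nil
    exact ⟨rfl, .inl ⟨by simp, by simp [instLen_chord]⟩⟩
  · obtain ⟨hy7, hs, he, hc⟩ := walk_eq_climb 6 1 p rfl (by decide) hp.1 (by
        intro l hl hmem
        obtain rfl : l = 0 := by omega
        exact hp.2 hmem) (fun a hE ha => hr a hE (by simp [ha])) hy (fun h' => h7 (by simp [h']))
    refine ⟨hy7, .inr ⟨fun ε => ?_, fun l => ?_, ?_⟩⟩
    · rw [SimpleGraph.Walk.edges_cons, List.mem_cons, he]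
      constructor
      · rintro (rfl | ⟨a, b, h1, h2, rfl⟩)
        · exact ⟨0, 1, rfl, rfl⟩
        · exact ⟨a, b, h2, rfl⟩
      · rintro ⟨a, b, h2, rfl⟩
        by_cases hai : a = 0
        · left
          obtain rfl : b = 1 := by omega
          rw [hai]
        · exact .inr ⟨a, b, by omega, h2, rfl⟩
    · by_cases hli : l = 0
      · simp [hli]
      · simp [hs l (by omega)]
    · rw [SimpleGraph.Walk.edges_cons, List.map_cons, List.sum_cons, hc, instLen_step rfl]
      rfl

theorem IsLabelling.inr_unique (hL : IsLabelling G σ fs sn) {a b : Sym2 V × Fin 2} {c : V × Fin 8}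
    (ha : (instGraph G σ fs sn).Adj (Sum.inr a) (Sum.inl c))
    (hb : (instGraph G σ fs sn).Adj (Sum.inr b) (Sum.inl c)) : a = b := by
  obtain ⟨e, k⟩ := a
  obtain ⟨e', k'⟩ := b
  obtain ⟨x, i⟩ := c
  obtain ⟨h1, h2⟩ := hL.adj_inr_inl.1 ha
  obtain ⟨h3, h4⟩ := hL.adj_inr_inl.1 hb
  have h5 := hL.mem x e h1
  have h6 := hL.mem x e' h3
  obtain rfl := hL.inj x h1 h3 (by omega)
  rcases h2 with ⟨h2, rfl⟩ | ⟨h2, rfl⟩ <;> rcases h4 with ⟨h4, rfl⟩ | ⟨h4, rfl⟩ <;>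
    first | rfl | omega

/-- A path joining two terminals of `B` enters some gadget, has length at least three, and has
length three only if it is the detour of a single edge of `G`. -/
theorem IsLabelling.walk_from_inr (hL : IsLabelling G σ fs sn) {a b : Sym2 V × Fin 2}
    (q : (instGraph G σ fs sn).Walk (Sum.inr a) (Sum.inr b)) (hp : q.IsPath) (hne : b ≠ a)
    (hr : ∀ c, c.1 ∈ G.edgeSet → Sum.inr c ∈ q.support → c = a ∨ c = b) :
    ∃ x ∈ a.1, (∃ i, Sum.inl (x, i) ∈ q.support) ∧ 3 ≤ (q.edges.map instLen).sum ∧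
      ((q.edges.map instLen).sum = 3 → ∀ ε, ε ∈ q.edges ↔ ε ∈ detourEdges σ fs a.1 x) := by
  cases q with
  | nil => exact absurd rfl hne
  | @cons _ c _ h p =>
  obtain ⟨x, i⟩ | c := c
  swap
  · exact absurd h instGraph_not_adj_inr_inr
  rw [SimpleGraph.Walk.cons_isPath_iff] at hp
  refine ⟨x, (hL.adj_inr_inl (k := a.2).1 h).1.2, ⟨i, by simp⟩, ?_⟩
  cases p with
  | @cons _ d _ h' p =>
  obtain ⟨w, j⟩ | d := d
  swap
  · obtain rfl | rfl := hr d (mem_edgeSet_of_adj_inr h'.symm) (by simp)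
    · exact absurd (by simp) hp.2
    · exact absurd (hL.inr_unique h h'.symm).symm hne
  rw [SimpleGraph.Walk.cons_isPath_iff] at hp
  obtain ⟨rfl, hij⟩ := instGraph_adj_inl_inl.1 h'
  cases p with
  | @cons _ d _ h'' p =>
  rw [SimpleGraph.Walk.cons_isPath_iff] at hp
  obtain ⟨l⟩ | d := d
  · have hpos : 1 ≤ (p.edges.map instLen).sum := by
      cases p with
      | cons h3 p3 =>
        rw [SimpleGraph.Walk.edges_cons, List.map_cons, List.sum_cons]
        exact Nat.le_add_right_of_le (instLen_pos _)
    have h1 := instLen_pos s(Sum.inl (x, i), Sum.inl (x, j))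
    have h2 := instLen_pos s(Sum.inl (x, j), Sum.inl l)
    simp only [SimpleGraph.Walk.edges_cons, List.map_cons, List.sum_cons, instLen_inr_inl]
    refine ⟨by omega, fun h => by omega⟩
  · have hdb : d = b := by
      obtain rfl | rfl := hr d (mem_edgeSet_of_adj_inr h''.symm) (by simp)
      · exact absurd (by simp) hp.2
      · rfl
    subst hdb
    obtain rfl := (SimpleGraph.Walk.isPath_iff_nil.1 hp.1.1.1).eq_nil
    obtain ⟨e, k⟩ := a
    obtain ⟨e', k'⟩ := d
    obtain ⟨m1, h1⟩ := hL.adj_inr_inl.1 h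
    obtain ⟨m2, h2⟩ := hL.adj_inr_inl.1 h''.symm
    have s1 := hL.mem x e m1
    have s2 := hL.mem x e' m2
    have h1' := instLen_pos s(Sum.inl (x, i), Sum.inl (x, j))
    have hlast : instLen s((Sum.inl (x, j) : IVert V), Sum.inr (e', k')) = 1 := by
      rw [Sym2.eq_swap]; exact instLen_inr_inl
    simp only [SimpleGraph.Walk.edges_cons, List.map_cons, List.sum_cons, instLen_inr_inl, hlast,
      SimpleGraph.Walk.edges_nil, List.map_nil, List.sum_nil]
    refine ⟨by omega, fun hsum ε => ?_⟩
    have hone : instLen s((Sum.inl (x, i) : IVert V), Sum.inl (x, j)) = 1 := by omega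
    have hone' : instLen s((Sum.inl (x, j) : IVert V), Sum.inl (x, i)) = 1 := by
      rwa [Sym2.eq_swap]
    have hcase : (i.val + 1 = j.val ∧ i.val % 2 = 1) ∨ (j.val + 1 = i.val ∧ j.val % 2 = 1) := by
      rcases hij with h3 | h3 | h3 | h3
      · rw [instLen_step h3] at hone
        split_ifs at hone <;> omega
      · rw [instLen_step h3] at hone'
        split_ifs at hone' <;> omega
      · omega
      · omega
    obtain rfl := hL.inj x m1 m2 (by omega)
    simp only [List.mem_cons, List.not_mem_nil, or_false, detourEdges, Set.mem_ofPred_eq]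
    rcases hcase with hc | hc
    · obtain ⟨h1, rfl⟩ | ⟨h1, rfl⟩ := h1
      swap
      · omega
      obtain ⟨h2, rfl⟩ | ⟨h2, rfl⟩ := h2
      · omega
      constructor
      · intro hε
        refine ⟨i, j, h1, h2, ?_⟩
        rcases hε with h | h | h
        exacts [.inl h, .inr (.inl h), .inr (.inr (h.trans Sym2.eq_swap))]
      · rintro ⟨i', j', h3, h4, hε⟩
        obtain rfl : i' = i := by omega
        obtain rfl : j' = j := by omega
        rcases hε with h | h | h
        exacts [.inl h, .inr (.inl h), .inr (.inr (h.trans Sym2.eq_swap))]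
    · obtain ⟨h1, rfl⟩ | ⟨h1, rfl⟩ := h1
      · omega
      obtain ⟨h2, rfl⟩ | ⟨h2, rfl⟩ := h2
      swap
      · omega
      constructor
      · intro hε
        refine ⟨j, i, h2, h1, ?_⟩
        rcases hε with h | h | h
        exacts [.inr (.inr h), .inr (.inl (h.trans Sym2.eq_swap)), .inl (h.trans Sym2.eq_swap)]
      · rintro ⟨i', j', h3, h4, hε⟩
        obtain rfl : i' = j := by omega
        obtain rfl : j' = i := by omega
        rcases hε with h | h | h
        exacts [.inr (.inr (h.trans Sym2.eq_swap)), .inr (.inl (h.trans Sym2.eq_swap)), .inl h]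


theorem fin_two_eq_or (k s : Fin 2) : k = s ∨ k = 1 - s := by
  revert k s; decide

theorem IsLabelling.exists_mem_detourEdges (hL : IsLabelling G σ fs sn) {e : Sym2 V} {x : V}
    (he : e ∈ G.incidenceSet x) (k : Fin 2) :
    ∃ i, s(Sum.inr (e, k), Sum.inl (x, i)) ∈ detourEdges σ fs e x := by
  have h := hL.mem x e he
  obtain ⟨i, j, hi, hj⟩ : ∃ i j : Fin 8, i.val + 1 = σ x e ∧ j.val = σ x e :=
    ⟨⟨σ x e - 1, by omega⟩, ⟨σ x e, by omega⟩, by simp only; omega, rfl⟩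
  obtain rfl | rfl := fin_two_eq_or k (side fs x e)
  · exact ⟨i, i, j, hi, hj, .inl rfl⟩
  · exact ⟨j, i, j, hi, hj, .inr (.inr rfl)⟩

theorem exists_long_walk (v : V) :
    ∃ q : (instGraph G σ fs sn).Walk (Sum.inl (v, 0)) (Sum.inl (v, 7)), q.IsPath ∧
      (∀ z ∈ q.support, ∃ j, z = Sum.inl (v, j)) ∧ (∀ ε, ε ∈ q.edges ↔ ε ∈ longEdges v) ∧
      (q.edges.map instLen).sum = 11 := by
  have h (i j : Fin 8) (hij : i.val + 1 = j.val) :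
      (instGraph G σ fs sn).Adj (Sum.inl (v, i)) (Sum.inl (v, j)) :=
    instGraph_adj_inl_inl.2 ⟨rfl, .inl hij⟩
  refine ⟨.cons (h 0 1 rfl) <| .cons (h 1 2 rfl) <| .cons (h 2 3 rfl) <| .cons (h 3 4 rfl) <|
    .cons (h 4 5 rfl) <| .cons (h 5 6 rfl) <| .cons (h 6 7 rfl) .nil, ?_, ?_, ?_, ?_⟩
  · simp [SimpleGraph.Walk.cons_isPath_iff]
  · simp
  · intro ε
    simp only [SimpleGraph.Walk.edges_cons, SimpleGraph.Walk.edges_nil, List.mem_cons,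
      List.not_mem_nil, or_false]
    constructor
    · rintro (h | h | h | h | h | h | h) <;> exact ⟨_, _, rfl, h⟩
    · rintro ⟨i, j, hij, rfl⟩
      obtain rfl : j = i + 1 := by omega
      fin_cases i <;> simp at hij ⊢
  · simp only [SimpleGraph.Walk.edges_cons, SimpleGraph.Walk.edges_nil, List.map_cons,
      List.map_nil, List.sum_cons, List.sum_nil]
    rw [instLen_step rfl, instLen_step rfl, instLen_step rfl, instLen_step rfl, instLen_step rfl,
      instLen_step rfl, instLen_step rfl]
    rfl

theorem IsLabelling.exists_detour_walk (hL : IsLabelling G σ fs sn) {e : Sym2 V} {x : V}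
    (he : e ∈ G.incidenceSet x) :
    ∃ q : (instGraph G σ fs sn).Walk (Sum.inr (e, side fs x e)) (Sum.inr (e, 1 - side fs x e)),
      q.IsPath ∧
      (∀ z ∈ q.support, (∃ k, z = Sum.inr (e, k)) ∨
        ∃ j : Fin 8, z = Sum.inl (x, j) ∧ (j.val + 1 = σ x e ∨ j.val = σ x e)) ∧
      (∀ ε, ε ∈ q.edges ↔ ε ∈ detourEdges σ fs e x) ∧ (q.edges.map instLen).sum = 3 := by
  have h := hL.mem x e he
  obtain ⟨i, j, hi, hj⟩ : ∃ i j : Fin 8, i.val + 1 = σ x e ∧ j.val = σ x e :=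
    ⟨⟨σ x e - 1, by omega⟩, ⟨σ x e, by omega⟩, by simp only; omega, rfl⟩
  have h1 : (instGraph G σ fs sn).Adj (Sum.inr (e, side fs x e)) (Sum.inl (x, i)) :=
    hL.adj_inr_inl.2 ⟨he, .inl ⟨hi, rfl⟩⟩
  have h2 : (instGraph G σ fs sn).Adj (Sum.inl (x, i)) (Sum.inl (x, j)) :=
    instGraph_adj_inl_inl.2 ⟨rfl, .inl (by omega)⟩
  have h3 : (instGraph G σ fs sn).Adj (Sum.inr (e, 1 - side fs x e)) (Sum.inl (x, j)) :=
    hL.adj_inr_inl.2 ⟨he, .inr ⟨hj, rfl⟩⟩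
  refine ⟨.cons h1 <| .cons h2 <| .cons h3.symm .nil, ?_, ?_, ?_, ?_⟩
  · have hij : i ≠ j := by omega
    have hs : ∀ s : Fin 2, s ≠ 1 - s := by decide
    simp [SimpleGraph.Walk.cons_isPath_iff, hij, hs]
  · simp only [SimpleGraph.Walk.support_cons, SimpleGraph.Walk.support_nil, List.mem_cons,
      List.not_mem_nil, or_false]
    rintro z (rfl | rfl | rfl | rfl)
    exacts [.inl ⟨_, rfl⟩, .inr ⟨i, rfl, .inl hi⟩, .inr ⟨j, rfl, .inr hj⟩, .inl ⟨_, rfl⟩]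
  · intro ε
    simp only [SimpleGraph.Walk.edges_cons, SimpleGraph.Walk.edges_nil, List.mem_cons,
      List.not_mem_nil, or_false, detourEdges, Set.mem_ofPred_eq]
    constructor
    · intro hε
      refine ⟨i, j, hi, hj, ?_⟩
      rcases hε with h | h | h
      exacts [.inl h, .inr (.inl h), .inr (.inr (h.trans Sym2.eq_swap))]
    · rintro ⟨i', j', h3, h4, hε⟩
      obtain rfl : i' = i := by omega
      obtain rfl : j' = j := by omega
      rcases hε with h | h | h
      exacts [.inl h, .inr (.inl h), .inr (.inr (h.trans Sym2.eq_swap))]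
  · have hlast : instLen s((Sum.inl (x, j) : IVert V), Sum.inr (e, 1 - side fs x e)) = 1 := by
      rw [Sym2.eq_swap]; exact instLen_inr_inl
    simp only [SimpleGraph.Walk.edges_cons, List.map_cons, List.sum_cons, instLen_inr_inl, hlast,
      SimpleGraph.Walk.edges_nil, List.map_nil, List.sum_nil]
    rw [instLen_step (by omega), if_neg (by omega), add_zero]

section Finite

variable [Fintype V] [DecidableEq V] [DecidableRel G.Adj]

omit [DecidableRel G.Adj] in
theorem mem_instA {z : IVert V} :
    z ∈ instA V ↔ ∃ v, z = Sum.inl (v, 0) ∨ z = Sum.inl (v, 7) := by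
  simp [instA, eq_comm, exists_or]

theorem mem_instB {z : IVert V} : z ∈ instB G ↔ ∃ a, a.1 ∈ G.edgeSet ∧ z = Sum.inr a := by
  simp only [instB, Finset.mem_union, Finset.mem_image, SimpleGraph.mem_edgeFinset]
  constructor
  · rintro (⟨e, he, rfl⟩ | ⟨e, he, rfl⟩) <;> exact ⟨_, he, rfl⟩
  · rintro ⟨⟨e, k⟩, he, rfl⟩
    fin_cases k
    exacts [.inl ⟨e, he, rfl⟩, .inr ⟨e, he, rfl⟩]

theorem card_instA : (instA V).card = 2 * Fintype.card V := by
  rw [instA, Finset.card_union_of_disjoint, Finset.card_image_of_injective,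
    Finset.card_image_of_injective, Finset.card_univ, two_mul]
  · intro a b h; simpa using h
  · intro a b h; simpa using h
  · simp [Finset.disjoint_left]

theorem card_instB : (instB G).card = 2 * G.edgeFinset.card := by
  rw [instB, Finset.card_union_of_disjoint, Finset.card_image_of_injective,
    Finset.card_image_of_injective, two_mul]
  · intro a b h; simpa using h
  · intro a b h; simpa using h
  · simp [Finset.disjoint_left]

theorem disjoint_instA_instB : Disjoint (instA V) (instB G) := by
  rw [Finset.disjoint_left]
  intro z hA hB
  obtain ⟨v, rfl | rfl⟩ := mem_instA.1 hA <;> obtain ⟨a, -, h⟩ := mem_instB.1 hB <;> simp at h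

theorem even_card_instA_add_card_instB : Even ((instA V).card + (instB G).card) := by
  rw [card_instA, card_instB, ← mul_add]
  exact even_two_mul _

/-- The selections given by a vertex set `S` and a choice of endpoints outside `S` are
solutions. -/
theorem IsLabelling.isSolution_selection (hL : IsLabelling G σ fs sn) (S : Finset V)
    (x : G.edgeSet → V) (hx : ∀ e, x e ∈ e.1 ∧ x e ∉ S) :
    IsSolution (instGraph G σ fs sn) (instA V) (instB G) (selection G σ fs S x) ∧
      lengthOf instLen (selection G σ fs S x) + S.card =
        12 * Fintype.card V + 3 * G.edgeFinset.card := by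
  have hV (v : V) : ∃ q : (instGraph G σ fs sn).Walk (Sum.inl (v, 0)) (Sum.inl (v, 7)),
      q.IsPath ∧ (∀ z ∈ q.support, ∃ j, z = Sum.inl (v, j) ∧ (v ∈ S ∨ j = 0 ∨ j = 7)) ∧
      (∀ ε, ε ∈ q.edges ↔ v ∉ S ∧ ε = s(Sum.inl (v, 0), Sum.inl (v, 7)) ∨
        v ∈ S ∧ ε ∈ longEdges v) ∧
      (q.edges.map instLen).sum + (if v ∈ S then 1 else 0) = 12 := by
    by_cases hv : v ∈ S
    · obtain ⟨q, h1, h2, h3, h4⟩ := exists_long_walk (G := G) (σ := σ) (fs := fs) (sn := sn) v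
      refine ⟨q, h1, fun z hz => ?_, by simpa [hv] using h3, by simp [hv, h4]⟩
      obtain ⟨j, hj⟩ := h2 z hz
      exact ⟨j, hj, .inl hv⟩
    · have h : (instGraph G σ fs sn).Adj (Sum.inl (v, 0)) (Sum.inl (v, 7)) :=
        instGraph_adj_inl_inl.2 ⟨rfl, by simp⟩
      refine ⟨.cons h .nil, by simp, ?_, by simp [hv], by simp [hv, instLen_chord]⟩
      simp
  have hE (e : G.edgeSet) := hL.exists_detour_walk (e := e.1) (x := x e) ⟨e.2, (hx e).1⟩
  choose p hp1 hp2 hp3 hp4 using hV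
  choose q hq1 hq2 hq3 hq4 using hE
  let g : V ⊕ G.edgeSet → (u : IVert V) × (v : IVert V) × (instGraph G σ fs sn).Walk u v :=
    Sum.elim (fun v => ⟨_, _, p v⟩) (fun e => ⟨_, _, q e⟩)
  have hmain : IsSolution (instGraph G σ fs sn) (instA V) (instB G) (selection G σ fs S x) ∧
      lengthOf instLen (selection G σ fs S x) = ∑ t, ((g t).2.2.edges.map instLen).sum := by
    refine isSolution_of_fintype g instLen ?_ ?_ ?_ ?_ ?_ ?_
    · rw [card_instA, card_instB, Fintype.card_sum, SimpleGraph.edgeFinset_card]; omega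
    · rintro (v | e)
      exacts [hp1 v, hq1 e]
    · rintro (v | e)
      · exact .inl ⟨mem_instA.2 ⟨v, .inl rfl⟩, mem_instA.2 ⟨v, .inr rfl⟩⟩
      · exact .inr ⟨mem_instB.2 ⟨_, e.2, rfl⟩, mem_instB.2 ⟨_, e.2, rfl⟩⟩
    · have key : ∀ v e z, z ∈ (p v).support → z ∉ (q e).support := by
        intro v e z h1 h2
        obtain ⟨j, rfl, h3⟩ := hp2 v z h1
        obtain ⟨k, h4⟩ | ⟨l, h4, h5⟩ := hq2 e _ h2
        · simp at h4
        · simp only [Sum.inl.injEq, Prod.mk.injEq] at h4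
          obtain ⟨rfl, rfl⟩ := h4
          have := hL.mem (x e) e ⟨e.2, (hx e).1⟩
          rcases h3 with h3 | rfl | rfl
          · exact (hx e).2 h3
          · simp at h5; omega
          · simp at h5; omega
      rintro (v | e) (w | d) hne z h1 h2
      · obtain ⟨j, rfl, -⟩ := hp2 v z h1
        obtain ⟨l, h4, -⟩ := hp2 w _ h2
        simp only [Sum.inl.injEq, Prod.mk.injEq] at h4
        exact hne (by rw [h4.1])
      · exact key v d z h1 h2
      · exact key w e z h2 h1
      · apply hne
        obtain ⟨k, rfl⟩ | ⟨l, rfl, h5⟩ := hq2 e z h1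
        · obtain ⟨k', h⟩ | ⟨l', h, -⟩ := hq2 d _ h2
          · simp only [Sum.inr.injEq, Prod.mk.injEq] at h
            rw [Subtype.ext h.1]
          · simp at h
        · obtain ⟨k', h⟩ | ⟨l', h, h6⟩ := hq2 d _ h2
          · simp at h
          · simp only [Sum.inl.injEq, Prod.mk.injEq] at h
            obtain ⟨h, rfl⟩ := h
            have m1 : e.1 ∈ G.incidenceSet (x e) := ⟨e.2, (hx e).1⟩
            have m2 : d.1 ∈ G.incidenceSet (x e) := ⟨d.2, h ▸ (hx d).1⟩
            rw [← h] at h6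
            have s1 := hL.mem _ _ m1
            have s2 := hL.mem _ _ m2
            rw [Subtype.ext (hL.inj _ m1 m2 (by omega))]
    · intro z hz
      obtain hz | hz := Finset.mem_union.1 hz
      · obtain ⟨v, hv⟩ := mem_instA.1 hz
        exact ⟨.inl v, hv⟩
      · obtain ⟨⟨e, k⟩, he, rfl⟩ := mem_instB.1 hz
        refine ⟨.inr ⟨e, he⟩, ?_⟩
        simpa [g] using fin_two_eq_or k _
    · intro ε
      simp only [selection, Set.mem_ofPred_eq, Sum.exists, g, Sum.elim_inl, Sum.elim_inr, hp3, hq3,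
        exists_or, or_assoc]
  refine ⟨hmain.1, ?_⟩
  rw [hmain.2, Fintype.sum_sum_type]
  simp only [g, Sum.elim_inl, Sum.elim_inr, hq4]
  have h1 : ∑ v, (((p v).edges.map instLen).sum + (if v ∈ S then 1 else 0)) =
      12 * Fintype.card V := by
    simp [hp4, mul_comm]
  rw [Finset.sum_add_distrib] at h1
  have h2 : ∑ v, (if v ∈ S then 1 else 0) = S.card := by simp
  have h3 : ∑ _e : G.edgeSet, 3 = 3 * G.edgeFinset.card := by
    rw [Finset.sum_const, Finset.card_univ, SimpleGraph.edgeFinset_card, smul_eq_mul, mul_comm]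
  omega


/-- In every solution, the path at `v′₁` ends at `v′₈`, and it is the edge `v′₁v′₈` or the path
`v′₁ … v′₈`. -/
theorem IsPathFamily.exists_index_vertex {E' : Set (Sym2 (IVert V))} {k : ℕ}
    {f : Fin k → (u : IVert V) × (v : IVert V) × (instGraph G σ fs sn).Walk u v}
    (hf : IsPathFamily (instGraph G σ fs sn) (instA V) (instB G) E' f) (v : V) :
    ∃ i, Sum.inl (v, 0) ∈ (f i).2.2.support ∧ Sum.inl (v, 7) ∈ (f i).2.2.support ∧
      (∀ t ∈ instA V ∪ instB G, t ∈ (f i).2.2.support →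
        t = Sum.inl (v, 0) ∨ t = Sum.inl (v, 7)) ∧
      (((∀ ε, ε ∈ (f i).2.2.edges ↔ ε = s(Sum.inl (v, 0), Sum.inl (v, 7))) ∧
          ((f i).2.2.edges.map instLen).sum = 12) ∨
        ((∀ ε, ε ∈ (f i).2.2.edges ↔ ε ∈ longEdges v) ∧
          (∀ j, Sum.inl (v, j) ∈ (f i).2.2.support) ∧
          ((f i).2.2.edges.map instLen).sum = 11)) := by
  have hA : (Sum.inl (v, 0) : IVert V) ∈ instA V := mem_instA.2 ⟨v, .inl rfl⟩
  obtain ⟨i, hi⟩ := hf.2.2.2.2.1 _ (Finset.mem_union_left _ hA)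
  obtain ⟨y, q, hp, hne, hy, hs, he, ht⟩ := hf.exists_walk disjoint_instA_instB
    even_card_instA_add_card_instB i _ hi
  have hyA : y ∈ instA V := by
    obtain h | h := hy
    · exact h.2
    · exact absurd h.1 (Finset.disjoint_left.1 disjoint_instA_instB hA)
  obtain ⟨rfl, hq⟩ := walk_from_first q hp hne (fun a ha haq => by
      have haB : (Sum.inr a : IVert V) ∈ instB G := mem_instB.2 ⟨a, ha, rfl⟩
      obtain h | h := ht _ (Finset.mem_union_right _ haB) haq
      · simp at h
      · exact Finset.disjoint_left.1 disjoint_instA_instB hyA (h ▸ haB))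
    (mem_instA.1 hyA) (fun h7 => by
      obtain h | h := ht _ (Finset.mem_union_left _ (mem_instA.2 ⟨v, .inr rfl⟩)) h7
      · simp at h
      · exact h.symm)
  refine ⟨i, ?_⟩
  simp only [← hs, ← he.mem_iff, ← (he.map instLen).sum_eq]
  exact ⟨by simp, by simp, ht, hq⟩

/-- In every solution, a path ending at a terminal of the edge `e` enters the gadget of an
endpoint of `e`. -/
theorem IsLabelling.exists_gadget_of_endpoint (hL : IsLabelling G σ fs sn)
    {E' : Set (Sym2 (IVert V))} {k : ℕ}
    {f : Fin k → (u : IVert V) × (v : IVert V) × (instGraph G σ fs sn).Walk u v}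
    (hf : IsPathFamily (instGraph G σ fs sn) (instA V) (instB G) E' f)
    {a : Sym2 V × Fin 2} (ha : a.1 ∈ G.edgeSet) {i : Fin k}
    (hi : Sum.inr a = (f i).1 ∨ Sum.inr a = (f i).2.1) :
    ∃ x ∈ a.1, (∃ j, Sum.inl (x, j) ∈ (f i).2.2.support) ∧
      3 ≤ ((f i).2.2.edges.map instLen).sum ∧
      (((f i).2.2.edges.map instLen).sum = 3 →
        ∀ ε, ε ∈ (f i).2.2.edges ↔ ε ∈ detourEdges σ fs a.1 x) := by
  have hB : (Sum.inr a : IVert V) ∈ instB G := mem_instB.2 ⟨a, ha, rfl⟩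
  obtain ⟨y, q, hp, hne, hy, hs, he, ht⟩ := hf.exists_walk disjoint_instA_instB
    even_card_instA_add_card_instB i _ hi
  have hyB : y ∈ instB G := by
    obtain h | h := hy
    · exact absurd hB (Finset.disjoint_left.1 disjoint_instA_instB h.1)
    · exact h.2
  obtain ⟨b, hb, rfl⟩ := mem_instB.1 hyB
  simp only [← hs, ← he.mem_iff, ← (he.map instLen).sum_eq]
  refine hL.walk_from_inr q hp (fun h => hne (by rw [h])) fun c hc hcq => ?_
  simpa using ht _ (Finset.mem_union_right _ (mem_instB.2 ⟨c, hc, rfl⟩)) hcq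

/-- Every solution determines an independent set giving a lower bound for its length; the
solutions attaining the bound are selections. -/
theorem IsLabelling.exists_indep_of_isSolution (hL : IsLabelling G σ fs sn)
    {E' : Set (Sym2 (IVert V))}
    (h : IsSolution (instGraph G σ fs sn) (instA V) (instB G) E') :
    ∃ S : Finset V, (∀ u ∈ S, ∀ w ∈ S, ¬ G.Adj u w) ∧
      12 * Fintype.card V + 3 * G.edgeFinset.card ≤ lengthOf instLen E' + S.card ∧
      (lengthOf instLen E' + S.card = 12 * Fintype.card V + 3 * G.edgeFinset.card →
        ∃ x : G.edgeSet → V, (∀ e, x e ∈ e.1 ∧ x e ∉ S) ∧ E' = selection G σ fs S x) := by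
  obtain ⟨k, f, hf⟩ := h
  choose a ha0 ha7 hat hae using hf.exists_index_vertex
  have huniq : ∀ {i j : Fin k} {t}, t ∈ (f i).2.2.support → t ∈ (f j).2.2.support → i = j := by
    intro i j t h1 h2
    by_contra hij
    exact hf.2.2.2.1 i j hij t h1 h2
  have hb : ∀ e : G.edgeSet, ∃ i, Sum.inr (e.1, (0 : Fin 2)) = (f i).1 ∨
      Sum.inr (e.1, (0 : Fin 2)) = (f i).2.1 := fun e => hf.2.2.2.2.1 _
    (Finset.mem_union_right _ (mem_instB.2 ⟨_, e.2, rfl⟩))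
  choose b hb using hb
  choose x hxe hxs hx3 hx using fun e : G.edgeSet =>
    hL.exists_gadget_of_endpoint hf (a := (e.1, 0)) e.2 (hb e)
  have hbsupp : ∀ e, Sum.inr (e.1, (0 : Fin 2)) ∈ (f (b e)).2.2.support := by
    intro e
    obtain h | h := hb e <;> rw [h] <;> simp
  have hab : ∀ v e, a v ≠ b e := by
    intro v e h
    have := hat v _ (Finset.mem_union_right _ (mem_instB.2 ⟨_, e.2, rfl⟩)) (h ▸ hbsupp e)
    simp at this
  have hainj : Function.Injective a := by
    intro v w h
    have := hat v _ (Finset.mem_union_left _ (mem_instA.2 ⟨w, .inl rfl⟩)) (h ▸ ha0 w)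
    simpa [eq_comm] using this
  have hB : ∀ i, i ∉ Finset.univ.image a → ∃ c, c.1 ∈ G.edgeSet ∧ Sum.inr c = (f i).1 := by
    intro i hi
    obtain h | h := hf.2.2.1 i
    · exfalso
      obtain ⟨v, hv⟩ := mem_instA.1 h.1
      refine hi (Finset.mem_image.2 ⟨v, Finset.mem_univ _, ?_⟩)
      have hs := (f i).2.2.start_mem_support
      obtain hv | hv := hv
      · exact huniq (ha0 v) (hv ▸ hs)
      · exact huniq (ha7 v) (hv ▸ hs)
    · obtain ⟨c, hc, hc'⟩ := mem_instB.1 h.1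
      exact ⟨c, hc, hc'.symm⟩
  let cost : Fin k → ℕ := fun i => ((f i).2.2.edges.map instLen).sum
  let S : Finset V := Finset.univ.filter fun v => cost (a v) = 11
  have hS : ∀ v, (v ∉ S ∧ (∀ ε, ε ∈ (f (a v)).2.2.edges ↔ ε = s(Sum.inl (v, 0), Sum.inl (v, 7))) ∧
      cost (a v) = 12) ∨ (v ∈ S ∧ (∀ ε, ε ∈ (f (a v)).2.2.edges ↔ ε ∈ longEdges v) ∧
      (∀ j, Sum.inl (v, j) ∈ (f (a v)).2.2.support) ∧ cost (a v) = 11) := by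
    intro v
    obtain h | h := hae v
    · exact .inl ⟨by simp [S, cost, h.2], h⟩
    · exact .inr ⟨by simp [S, cost, h.2.2], h⟩
  have hxS : ∀ e, x e ∉ S := by
    intro e he
    obtain ⟨j, hj⟩ := hxs e
    obtain h | h := hS (x e)
    · exact h.1 he
    · exact hab _ _ (huniq (h.2.2.1 j) hj)
  have hk : k = Fintype.card V + G.edgeFinset.card := by
    have := hf.1
    rw [card_instA, card_instB] at this
    omega
  let R : Finset (Fin k) := (Finset.univ.image a)ᶜ
  have hR : R.card = G.edgeFinset.card := by
    rw [Finset.card_compl, Finset.card_image_of_injective _ hainj, Finset.card_univ,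
      Fintype.card_fin]
    omega
  have hR3 : ∀ i ∈ R, 3 ≤ cost i := by
    intro i hi
    obtain ⟨c, hc, hci⟩ := hB i (Finset.mem_compl.1 hi)
    obtain ⟨-, -, -, h3, -⟩ := hL.exists_gadget_of_endpoint hf hc (.inl hci)
    exact h3
  have hlen : lengthOf instLen E' = ∑ v, cost (a v) + ∑ i ∈ R, cost i := by
    rw [hf.lengthOf_eq, ← Finset.sum_add_sum_compl (Finset.univ.image a),
      Finset.sum_image hainj.injOn]
  have hsumA : ∑ v, cost (a v) + S.card = 12 * Fintype.card V := by
    have h1 : S.card = ∑ v, if v ∈ S then 1 else 0 := by simp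
    rw [h1, ← Finset.sum_add_distrib, Finset.sum_congr rfl (g := fun _ => 12)]
    · simp [mul_comm]
    · intro v _
      obtain h | h := hS v
      · rw [if_neg h.1, h.2.2]
      · rw [if_pos h.1, h.2.2.2]
  have hsum3 : ∑ _i ∈ R, 3 = 3 * G.edgeFinset.card := by
    rw [Finset.sum_const, hR, smul_eq_mul, mul_comm]
  have hsumB := Finset.sum_le_sum hR3
  refine ⟨S, fun u hu w hw huw => ?_, by omega, fun heq => ⟨x, fun e => ⟨hxe e, hxS e⟩, ?_⟩⟩
  · have h1 := hxe ⟨s(u, w), huw⟩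
    have h2 := hxS ⟨s(u, w), huw⟩
    simp only [Sym2.mem_iff] at h1
    obtain h | h := h1 <;> rw [h] at h2 <;> contradiction
  · have hcost : ∀ i ∈ R, cost i = 3 := fun i hi =>
      ((Finset.sum_eq_sum_iff_of_le hR3).1 (by omega) i hi).symm
    have hbR : ∀ e, b e ∈ R := by
      intro e
      simp only [R, Finset.mem_compl, Finset.mem_image, Finset.mem_univ, true_and, not_exists]
      exact fun v => hab v e
    have hx' : ∀ e, ∀ ε, ε ∈ (f (b e)).2.2.edges ↔ ε ∈ detourEdges σ fs e (x e) := fun e =>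
      hx e (hcost _ (hbR e))
    have hRb : ∀ i ∈ R, ∃ e, b e = i := by
      intro i hi
      obtain ⟨⟨e, c⟩, hc, hci⟩ := hB i (Finset.mem_compl.1 hi)
      refine ⟨⟨e, hc⟩, ?_⟩
      obtain ⟨j, hj⟩ := hL.exists_mem_detourEdges (e := e) (x := x ⟨e, hc⟩)
        ⟨hc, hxe ⟨e, hc⟩⟩ c
      rw [← hx' ⟨e, hc⟩] at hj
      have hs : Sum.inr (e, c) ∈ (f i).2.2.support := by
        rw [hci]; exact (f i).2.2.start_mem_support
      exact huniq ((f _).2.2.fst_mem_support_of_mem_edges hj) hs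
    rw [hf.2.2.2.2.2]
    ext ε
    simp only [Set.mem_iUnion, Set.mem_ofPred_eq, selection]
    constructor
    · rintro ⟨i, hi⟩
      by_cases hiR : i ∈ R
      · obtain ⟨e, rfl⟩ := hRb i hiR
        exact .inr (.inr ⟨e, (hx' e ε).1 hi⟩)
      · obtain ⟨v, -, rfl⟩ := Finset.mem_image.1 (Finset.notMem_compl.1 hiR)
        obtain h | h := hS v
        · exact .inl ⟨v, h.1, (h.2.1 ε).1 hi⟩
        · exact .inr (.inl ⟨v, h.1, (h.2.1 ε).1 hi⟩)
    · rintro (⟨v, hv, hε⟩ | ⟨v, hv, hε⟩ | ⟨e, hε⟩)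
      · obtain h | h := hS v
        · exact ⟨a v, (h.2.1 ε).2 hε⟩
        · exact absurd h.1 hv
      · obtain h | h := hS v
        · exact absurd hv h.1
        · exact ⟨a v, (h.2.1 ε).2 hε⟩
      · exact ⟨b e, (hx' e ε).2 hε⟩

omit [Fintype V] [DecidableEq V] [DecidableRel G.Adj] in
theorem IsLabelling.selection_injective (hL : IsLabelling G σ fs sn) {S T : Finset V}
    {x y : G.edgeSet → V} (hx : ∀ e, x e ∈ e.1)
    (h : selection G σ fs S x = selection G σ fs T y) : S = T ∧ x = y := by
  constructor
  · have key : ∀ (S : Finset V) (x : G.edgeSet → V) (v : V),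
        s(Sum.inl (v, 0), Sum.inl (v, 7)) ∈ selection G σ fs S x ↔ v ∉ S := by
      intro S x v
      constructor
      · rintro (⟨w, hw, h⟩ | ⟨w, -, i, j, hij, h⟩ | ⟨e, i, j, hi, hj, h⟩)
        · simp at h
          exact h ▸ hw
        · simp only [Sym2.eq_iff, Sum.inl.injEq, Prod.mk.injEq] at h
          omega
        · obtain h | h | h := h <;>
            simp only [Sym2.eq_iff, Sum.inl.injEq, Prod.mk.injEq, reduceCtorEq, false_and,
              and_false, or_false] at h
          omega
      · exact fun hv => .inl ⟨v, hv, rfl⟩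
    ext v
    have := key S x v
    rw [h, key T y v] at this
    exact (not_iff_not.1 this).symm
  · funext e
    obtain ⟨i, hi⟩ := hL.exists_mem_detourEdges (e := e) (x := x e) ⟨e.2, hx e⟩ 0
    have hmem : s(Sum.inr (e.1, 0), Sum.inl (x e, i)) ∈ selection G σ fs S x :=
      .inr (.inr ⟨e, hi⟩)
    rw [h] at hmem
    obtain ⟨w, -, h⟩ | ⟨w, -, i, j, hij, h⟩ | ⟨d, i, j, hi, hj, h⟩ := hmem
    · simp at h
    · simp at h
    · obtain h | h | h := h <;> simp at h <;> obtain ⟨⟨h1, -⟩, h2, -⟩ := h <;>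
        rw [h2, Subtype.ext h1]

omit [DecidableEq V] [DecidableRel G.Adj] in
theorem card_le_indepNum {S : Finset V} (hS : ∀ u ∈ S, ∀ w ∈ S, ¬ G.Adj u w) :
    S.card ≤ indepNum G :=
  le_csSup ⟨Fintype.card V, by rintro n ⟨T, -, rfl⟩; exact T.card_le_univ⟩ ⟨S, hS, rfl⟩

omit [DecidableEq V] [DecidableRel G.Adj] in
theorem exists_card_eq_indepNum :
    ∃ S : Finset V, (∀ u ∈ S, ∀ w ∈ S, ¬ G.Adj u w) ∧ S.card = indepNum G :=
  Nat.sSup_mem (s := {n | ∃ S : Finset V, (∀ u ∈ S, ∀ w ∈ S, ¬ G.Adj u w) ∧ S.card = n})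
    ⟨0, ∅, by simp⟩ ⟨Fintype.card V, by rintro n ⟨T, -, rfl⟩; exact T.card_le_univ⟩

/-- The number of edges of a cubic graph meeting an independent set. -/
theorem card_edges_meeting_indep (hcubic : ∀ v, G.degree v = 3) {S : Finset V}
    (hS : ∀ u ∈ S, ∀ w ∈ S, ¬ G.Adj u w) :
    (G.edgeFinset.filter fun e => ∃ v ∈ S, v ∈ e).card = 3 * S.card := by
  have : (G.edgeFinset.filter fun e => ∃ v ∈ S, v ∈ e) = S.biUnion fun v => G.incidenceFinset v := by
    ext e
    simp only [Finset.mem_filter, SimpleGraph.mem_edgeFinset, Finset.mem_biUnion,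
      SimpleGraph.mem_incidenceFinset, SimpleGraph.incidenceSet, Set.mem_ofPred_eq]
    tauto
  rw [this, Finset.card_biUnion]
  · simp [hcubic, mul_comm]
  · intro u hu w hw huw
    rw [Function.onFun, Finset.disjoint_left]
    intro e h1 h2
    rw [SimpleGraph.mem_incidenceFinset] at h1 h2
    exact hS u hu w hw (G.adj_of_mem_incidenceSet huw h1 h2)

/-- The choices of an endpoint outside an independent set for every edge. -/
theorem card_choices (hcubic : ∀ v, G.degree v = 3) {S : Finset V}
    (hS : ∀ u ∈ S, ∀ w ∈ S, ¬ G.Adj u w) :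
    (Fintype.piFinset fun e : G.edgeSet => Finset.univ.filter fun v => v ∈ e.1 ∧ v ∉ S).card =
      2 ^ (G.edgeFinset.card - 3 * S.card) := by
  have hcard (e : Sym2 V) (he : e ∈ G.edgeFinset) :
      (Finset.univ.filter fun v => v ∈ e ∧ v ∉ S).card =
        if ∃ v ∈ S, v ∈ e then 1 else 2 := by
    rw [SimpleGraph.mem_edgeFinset] at he
    induction e with
    | h u w =>
      have hne : u ≠ w := he.ne
      split_ifs with h
      · obtain ⟨v, hvS, hv⟩ := h
        rw [Finset.card_eq_one]
        rw [Sym2.mem_iff] at hv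
        obtain rfl | rfl := hv
        · have hw : w ∉ S := fun hw => hS _ hvS _ hw he
          refine ⟨w, ?_⟩
          ext t
          simp only [Sym2.mem_iff, Finset.mem_filter, Finset.mem_univ, true_and,
            Finset.mem_singleton]
          constructor
          · rintro ⟨rfl | rfl, h⟩
            exacts [absurd hvS h, rfl]
          · rintro rfl
            exact ⟨.inr rfl, hw⟩
        · have hu : u ∉ S := fun hu => hS _ hu _ hvS he
          refine ⟨u, ?_⟩
          ext t
          simp only [Sym2.mem_iff, Finset.mem_filter, Finset.mem_univ, true_and,
            Finset.mem_singleton]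
          constructor
          · rintro ⟨rfl | rfl, h⟩
            exacts [rfl, absurd hvS h]
          · rintro rfl
            exact ⟨.inl rfl, hu⟩
      · rw [← Finset.card_pair hne]
        congr 1
        ext v
        simp only [Sym2.mem_iff, Finset.mem_filter, Finset.mem_univ, true_and, Finset.mem_insert,
          Finset.mem_singleton] at h ⊢
        exact ⟨And.left, fun hv => ⟨hv, fun hvS => h ⟨v, hvS, hv⟩⟩⟩
  have hsplit := Finset.card_filter_add_card_filter_not (s := G.edgeFinset)
    (fun e => ∃ v ∈ S, v ∈ e)
  rw [card_edges_meeting_indep hcubic hS] at hsplit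
  rw [Fintype.card_piFinset, ← Finset.prod_subtype G.edgeFinset
    (fun e => SimpleGraph.mem_edgeFinset)
    (fun e => (Finset.univ.filter fun v => v ∈ e ∧ v ∉ S).card), Finset.prod_congr rfl hcard,
    Finset.prod_ite, Finset.prod_const_one, one_mul, Finset.prod_const, ← hsplit,
    Nat.add_sub_cancel_left]

end Finite

end Instance

/-!
STATEMENT 8.  The number of minimum-length solutions to Disjoint `A`,`B`-paths on the
instance `I` satisfies `S_{A,B} = m · 2^{|E| − 3α(G)}`, where `m` is the number of
maximum independent sets of `G`.
-/
theorem stmt8 {V : Type} [Fintype V] [DecidableEq V]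
    (G : SimpleGraph V) [DecidableRel G.Adj]
    (hcubic : ∀ v : V, G.degree v = 3)
    (σ : V → Sym2 V → ℕ) (fs sn : Sym2 V → V)
    (hfssn : ∀ e ∈ G.edgeSet, e = s(fs e, sn e))
    (hσmem : ∀ v : V, ∀ e ∈ G.incidenceSet v, σ v e = 2 ∨ σ v e = 4 ∨ σ v e = 6)
    (hσinj : ∀ v : V, Set.InjOn (σ v) (G.incidenceSet v)) :
    nSol (instGraph G σ fs sn) (instA V) (instB G) instLen =
      Set.ncard {S : Finset V | (∀ u ∈ S, ∀ w ∈ S, ¬ G.Adj u w) ∧ S.card = indepNum G}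
        * 2 ^ (G.edgeFinset.card - 3 * indepNum G) := by
  classical
  have hL : IsLabelling G σ fs sn := ⟨hfssn, hσmem, hσinj⟩
  let M : Finset (Finset V) :=
    Finset.univ.filter fun S => (∀ u ∈ S, ∀ w ∈ S, ¬ G.Adj u w) ∧ S.card = indepNum G
  let C : Finset V → Finset (G.edgeSet → V) := fun S =>
    Fintype.piFinset fun e => Finset.univ.filter fun v => v ∈ e.1 ∧ v ∉ S
  have hC : ∀ S x, x ∈ C S ↔ ∀ e, x e ∈ e.1 ∧ x e ∉ S := by simp [C]
  have hmin : lAB (instGraph G σ fs sn) (instA V) (instB G) instLen + indepNum G =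
      12 * Fintype.card V + 3 * G.edgeFinset.card := by
    obtain ⟨S, hS, hSc⟩ := exists_card_eq_indepNum (G := G)
    have hne : (C S).Nonempty := by
      rw [← Finset.card_pos, card_choices hcubic hS]
      positivity
    obtain ⟨x, hx⟩ := hne
    obtain ⟨hsol, hlen⟩ := hL.isSolution_selection S x ((hC S x).1 hx)
    have hle : lAB (instGraph G σ fs sn) (instA V) (instB G) instLen ≤ _ :=
      Nat.sInf_le ⟨_, hsol, rfl⟩
    obtain ⟨E', hE', hE'len⟩ : ∃ E', IsSolution (instGraph G σ fs sn) (instA V) (instB G) E' ∧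
        lengthOf instLen E' = lAB (instGraph G σ fs sn) (instA V) (instB G) instLen :=
      Nat.sInf_mem (s := {n | ∃ E', IsSolution (instGraph G σ fs sn) (instA V) (instB G) E' ∧
        lengthOf instLen E' = n}) ⟨_, _, hsol, rfl⟩
    obtain ⟨T, hT, hTlen, -⟩ := hL.exists_indep_of_isSolution hE'
    have := card_le_indepNum hT
    omega
  have hset : {E' | IsSolution (instGraph G σ fs sn) (instA V) (instB G) E' ∧
      lengthOf instLen E' = lAB (instGraph G σ fs sn) (instA V) (instB G) instLen} =
      (fun p : (_ : Finset V) × (G.edgeSet → V) => selection G σ fs p.1 p.2) ''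
        (M.sigma C : Finset _) := by
    ext E'
    simp only [Set.mem_ofPred_eq, Set.mem_image, Finset.mem_coe, Finset.mem_sigma, Sigma.exists,
      hC, M, Finset.mem_filter, Finset.mem_univ, true_and]
    constructor
    · rintro ⟨hsol, hlen⟩
      obtain ⟨S, hS, hle, h⟩ := hL.exists_indep_of_isSolution hsol
      have := card_le_indepNum hS
      obtain ⟨x, hx, rfl⟩ := h (by omega)
      exact ⟨S, x, ⟨⟨hS, by omega⟩, hx⟩, rfl⟩
    · rintro ⟨S, x, ⟨⟨hS, hSc⟩, hx⟩, rfl⟩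
      obtain ⟨hsol, hlen⟩ := hL.isSolution_selection S x hx
      exact ⟨hsol, by omega⟩
  have hM : {S : Finset V | (∀ u ∈ S, ∀ w ∈ S, ¬ G.Adj u w) ∧ S.card = indepNum G} =
      (M : Set (Finset V)) := by
    ext S
    simp [M]
  rw [nSol, hset, Set.InjOn.ncard_image, Set.ncard_coe_finset, Finset.card_sigma, hM,
    Set.ncard_coe_finset, ← smul_eq_mul, ← Finset.sum_const]
  · refine Finset.sum_congr rfl fun S hS => ?_
    obtain ⟨hS, hSc⟩ := (Finset.mem_filter.1 hS).2
    rw [card_choices hcubic hS, hSc]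
  · rintro ⟨S, x⟩ hx ⟨T, y⟩ - h
    have hx' := (hC S x).1 (Finset.mem_sigma.1 hx).2
    obtain ⟨rfl, rfl⟩ := hL.selection_injective (fun e => (hx' e).1) h
    rfl
end

section
/- Every simple path in the instance I whose two endpoints are distinct vertices of B has length at least 3. -/
theorem one_le_instLen {V : Type} (ε : Sym2 (IVert V)) : 1 ≤ instLen ε := by
  unfold instLen
  split_ifs <;> norm_num

theorem length_le_sum_instLen {V : Type} (l : List (Sym2 (IVert V))) :
    l.length ≤ (l.map instLen).sum := by
  simpa using List.length_le_sum_of_one_le (l.map instLen)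
    (by simpa using fun ε _ => one_le_instLen ε)

theorem exists_inr_of_mem_instB {V : Type} [Fintype V] [DecidableEq V] {G : SimpleGraph V}
    [DecidableRel G.Adj] {x : IVert V} (hx : x ∈ instB G) :
    ∃ e k, x = Sum.inr (e, k) := by
  simp only [instB, Finset.mem_union, Finset.mem_image] at hx
  obtain ⟨e, _, rfl⟩ | ⟨e, _, rfl⟩ := hx <;> exact ⟨_, _, rfl⟩

theorem not_instGraph_adj_inr_inr {V : Type} {G : SimpleGraph V} {σ : V → Sym2 V → ℕ}
    {fs sn : Sym2 V → V} (a b : Sym2 V × Fin 2) :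
    ¬ (instGraph G σ fs sn).Adj (Sum.inr a) (Sum.inr b) := by
  simp [instGraph, iRel]

theorem iRel_of_instGraph_adj {V : Type} {G : SimpleGraph V} {σ : V → Sym2 V → ℕ}
    {fs sn : Sym2 V → V} {a : Sym2 V × Fin 2} {b : V × Fin 8}
    (h : (instGraph G σ fs sn).Adj (Sum.inr a) (Sum.inl b)) :
    iRel G σ fs sn (Sum.inr a) (Sum.inl b) := by
  simpa [instGraph, iRel] using h

/-- A vertex of a gadget cycle has at most one neighbour outside its cycle. -/
theorem iRel_inr_inl_unique {V : Type} {G : SimpleGraph V} {σ : V → Sym2 V → ℕ}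
    {fs sn : Sym2 V → V} (hfssn : ∀ e ∈ G.edgeSet, e = s(fs e, sn e))
    (hσmem : ∀ v : V, ∀ e ∈ G.incidenceSet v, σ v e = 2 ∨ σ v e = 4 ∨ σ v e = 6)
    (hσinj : ∀ v : V, Set.InjOn (σ v) (G.incidenceSet v))
    {a b : Sym2 V × Fin 2} {c : V × Fin 8}
    (ha : iRel G σ fs sn (Sum.inr a) (Sum.inl c))
    (hb : iRel G σ fs sn (Sum.inr b) (Sum.inl c)) : a = b := by
  obtain ⟨e, k⟩ := a
  obtain ⟨f, l⟩ := b
  obtain ⟨w, i⟩ := c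
  obtain ⟨he, hek⟩ := ha
  obtain ⟨hf, hfl⟩ := hb
  have mem_incidence : ∀ e ∈ G.edgeSet, w = fs e ∨ w = sn e → e ∈ G.incidenceSet w := by
    intro e he h
    refine ⟨he, ?_⟩
    rw [hfssn e he]
    simpa using h
  have ends_ne : fs e ≠ sn e := by
    rw [hfssn e he, SimpleGraph.mem_edgeSet] at he
    exact he.ne
  have hew := mem_incidence e he (by tauto)
  have hfw := mem_incidence f hf (by tauto)
  have hσe := hσmem w e hew
  have hσf := hσmem w f hfw
  obtain rfl : e = f := hσinj w hew hfw (by omega)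
  have : k = l := by
    rcases hek with ⟨rfl, h, _⟩ | ⟨rfl, h, _⟩ | ⟨rfl, h, _⟩ | ⟨rfl, h, _⟩ <;>
      rcases hfl with ⟨rfl, h', _⟩ | ⟨rfl, h', _⟩ | ⟨rfl, h', _⟩ | ⟨rfl, h', _⟩ <;>
      first
        | rfl
        | omega
        | exact absurd (h.symm.trans h') ends_ne
        | exact absurd (h'.symm.trans h) ends_ne
  rw [this]

/-!
STATEMENT 10.  Every simple path in the instance `I` whose two endpoints are distinct
vertices of `B` has length at least `3`.
-/
theorem stmt10 {V : Type} [Fintype V] [DecidableEq V]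
    (G : SimpleGraph V) [DecidableRel G.Adj]
    (hcubic : ∀ v : V, G.degree v = 3)
    (σ : V → Sym2 V → ℕ) (fs sn : Sym2 V → V)
    (hfssn : ∀ e ∈ G.edgeSet, e = s(fs e, sn e))
    (hσmem : ∀ v : V, ∀ e ∈ G.incidenceSet v, σ v e = 2 ∨ σ v e = 4 ∨ σ v e = 6)
    (hσinj : ∀ v : V, Set.InjOn (σ v) (G.incidenceSet v))
    (x y : IVert V) (hx : x ∈ instB G) (hy : y ∈ instB G) (hxy : x ≠ y)
    (p : (instGraph G σ fs sn).Walk x y) (hp : p.IsPath) :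
    3 ≤ (p.edges.map instLen).sum := by
  refine le_trans ?_ (length_le_sum_instLen p.edges)
  rw [SimpleGraph.Walk.length_edges]
  obtain ⟨e, k, rfl⟩ := exists_inr_of_mem_instB hx
  obtain ⟨f, l, rfl⟩ := exists_inr_of_mem_instB hy
  match p with
  | .nil => exact absurd rfl hxy
  | .cons h .nil => exact absurd h (not_instGraph_adj_inr_inr _ _)
  | .cons (v := .inr b) h (.cons h' .nil) => exact absurd h (not_instGraph_adj_inr_inr _ _)
  | .cons (v := .inl c) h (.cons h' .nil) =>
    exact absurd (congrArg Sum.inr (iRel_inr_inl_unique hfssn hσmem hσinj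
      (iRel_of_instGraph_adj h) (iRel_of_instGraph_adj h'.symm))) hxy
  | .cons _ (.cons _ (.cons _ q)) => simp only [SimpleGraph.Walk.length_cons]; omega
end
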